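/- arXiv:2208.01410 — 2 statements merged into one kernel-verified Lean document; each statement's English description precedes it below -/
import Mathlib

section
/- Let v be a prime power and let t ≥ 3 be an odd integer. Then OCAN(t, v+2, t, v) ≤ v^t·(t − (2/(1−v))·(v^{−(t−1)/2} − 1)); equivalently, OCAN(t, v+2, t, v) ≤ t·v^t − (2/(v−1))·(v^t − v^{(t+1)/2}). -/
/-- An anti-ideal of the NRT poset `[m·s]`, whose elements are pairs
`(i, a) : Fin m × Fin s` (block `i`, position `a` within the block, positions
within a block forming a chain): an anti-ideal is an up-closed subset. -/
def IsAntiIdeal (m s : ℕ) (J : Finset (Fin m × Fin s)) : Prop :=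
  ∀ i : Fin m, ∀ a b : Fin s, a ≤ b → (i, a) ∈ J → (i, b) ∈ J

/-- Existence of an ordered covering array `OCA_λ(N; t, m, s, v)`:
an `N × ms` array over an alphabet of size `v`, columns indexed by the NRT poset
`[m·s]`, such that for every anti-ideal `J` of size `t`, every `t`-tuple appears
at least `lam` times as a row of the subarray given by the columns in `J`. -/
def IsOCA (lam N t m s v : ℕ) : Prop :=
  ∃ A : Fin N → Fin m × Fin s → Fin v,
    ∀ J : Finset (Fin m × Fin s), IsAntiIdeal m s J → J.card = t →
      ∀ f : Fin m × Fin s → Fin v,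
        lam ≤ (Finset.univ.filter (fun r : Fin N => ∀ c ∈ J, A r c = f c)).card

/-- The ordered covering array number `OCAN_λ(t, m, s, v)`. -/
noncomputable def OCAN (lam t m s v : ℕ) : ℕ := sInf {N | IsOCA lam N t m s v}

open Polynomial

/-- An up-closed set contains, in each block, as many top positions as it has elements there. -/
theorem IsAntiIdeal.mem_of_rev_lt {m s : ℕ} {J : Finset (Fin m × Fin s)} (hJ : IsAntiIdeal m s J)
    (i : Fin m) (p : Fin s)
    (hp : s - 1 - (p : ℕ) < (Finset.univ.filter (fun q : Fin s => (i, q) ∈ J)).card) :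
    (i, p) ∈ J := by
  by_contra hn
  have hsub : Finset.univ.filter (fun q : Fin s => (i, q) ∈ J) ⊆ Finset.Ioi p := by
    intro q hq
    rw [Finset.mem_filter] at hq
    rw [Finset.mem_Ioi]
    by_contra hle
    exact hn (hJ i q p (not_lt.mp hle) hq.2)
  have := Finset.card_le_card hsub
  rw [Fin.card_Ioi] at this
  omega

/-- The size of a set of cells is the sum of its block sizes. -/
theorem sum_card_block {m s : ℕ} (J : Finset (Fin m × Fin s)) :
    ∑ i, (Finset.univ.filter (fun q : Fin s => (i, q) ∈ J)).card = J.card := by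
  rw [Finset.card_eq_sum_card_fiberwise (f := Prod.fst) (t := Finset.univ) (by simp)]
  refine Finset.sum_congr rfl fun i _ => ?_
  refine Finset.card_bij (fun q _ => (i, q)) ?_ ?_ ?_
  · intro q hq
    simpa using hq
  · intro a _ b _ h
    simpa using h
  · rintro ⟨a, b⟩ h
    simp only [Finset.mem_filter] at h
    obtain ⟨h1, rfl⟩ := h
    exact ⟨b, by simpa using h1, rfl⟩

section Field

variable {F : Type*} [Field F]

/-- The polynomial of degree less than `n` whose coefficients are the first `n` entries of `w`. -/
noncomputable def vecPoly {t : ℕ} (n : ℕ) (w : Fin t → F) : F[X] :=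
  ∑ j ∈ Finset.range n, C (if h : j < t then w ⟨j, h⟩ else 0) * X ^ j

theorem coeff_vecPoly {t : ℕ} (n : ℕ) (w : Fin t → F) (j : ℕ) :
    (vecPoly n w).coeff j = if j < n then (if h : j < t then w ⟨j, h⟩ else 0) else 0 := by
  simp [vecPoly, coeff_C_mul, coeff_X_pow]

theorem coeff_vecPoly_of_le {t : ℕ} (n : ℕ) (w : Fin t → F) {j : ℕ} (h : n ≤ j) :
    (vecPoly n w).coeff j = 0 := by
  rw [coeff_vecPoly, if_neg (by omega)]

theorem apply_eq_of_vecPoly_eq {t n : ℕ} {w w' : Fin t → F} (h : vecPoly n w = vecPoly n w')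
    (j : Fin t) (hj : (j : ℕ) < n) : w j = w' j := by
  have := congrArg (fun p : F[X] => p.coeff j) h
  simpa [coeff_vecPoly, hj] using this

/-- Over a finite field there is a monic quadratic polynomial without roots. -/
theorem exists_monic_quadratic_no_root [Finite F] :
    ∃ g : F[X], g.Monic ∧ g.natDegree = 2 ∧ ∀ a, ¬ g.IsRoot a := by
  have hns : ¬ Function.Surjective (fun x : F => x ^ 2 - x) := by
    intro hs
    have hi := Finite.injective_iff_surjective.mpr hs
    exact zero_ne_one (hi (by simp) : (0 : F) = 1)
  simp only [Function.Surjective, not_forall, not_exists] at hns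
  obtain ⟨c, hc⟩ := hns
  refine ⟨X ^ 2 - X - C c, by monicity!, by compute_degree!, fun a ha => hc a ?_⟩
  simpa [sub_eq_zero] using ha

/-- Vanishing top coefficients of the remainders modulo powers of a monic quadratic force
divisibility by a power of it. -/
theorem pow_dvd_of_coeff_modByMonic {g f : F[X]} (hg : g.Monic) (hg2 : g.natDegree = 2) (i : ℕ)
    (h : ∀ j < 2 * i, (f %ₘ g ^ (j / 2 + 1)).coeff j = 0) : g ^ i ∣ f := by
  induction i with
  | zero => simp
  | succ i ih =>
    have hi := ih fun j hj => h j (by omega)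
    rw [← modByMonic_eq_zero_iff_dvd (hg.pow _)]
    have h0 := h (2 * i) (by omega)
    have h1 := h (2 * i + 1) (by omega)
    rw [show 2 * i / 2 + 1 = i + 1 by omega] at h0
    rw [show (2 * i + 1) / 2 + 1 = i + 1 by omega] at h1
    have hd : g ^ i ∣ f %ₘ g ^ (i + 1) := by
      rw [modByMonic_eq_sub_mul_div]
      exact dvd_sub hi ((pow_dvd_pow g (Nat.le_succ i)).mul_right _)
    have hlt : (f %ₘ g ^ (i + 1)).natDegree < 2 * i + 2 := by
      have := natDegree_modByMonic_lt f (hg.pow (i + 1)) (by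
        intro h
        have := congrArg natDegree h
        rw [hg.natDegree_pow, hg2, natDegree_one] at this
        omega)
      rw [hg.natDegree_pow, hg2] at this
      omega
    by_contra hne
    have hge := natDegree_le_of_dvd hd hne
    rw [hg.natDegree_pow, hg2] at hge
    refine hne (leadingCoeff_eq_zero.mp ?_)
    rw [leadingCoeff]
    obtain h | h : (f %ₘ g ^ (i + 1)).natDegree = 2 * i ∨
        (f %ₘ g ^ (i + 1)).natDegree = 2 * i + 1 := by omega
    · rw [h, h0]
    · rw [h, h1]

/-- A polynomial of degree less than `n` with `n` zeros, counted over the rational points of the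
projective line and a divisor without rational points, vanishes. -/
theorem eq_zero_of_zeros [Fintype F] {n e : ℕ} {f h : F[X]} {d : F → ℕ}
    (hf : ∀ j, n ≤ j → f.coeff j = 0) (hd : ∀ a, ∀ j < d a, (taylor a f).coeff j = 0)
    (he : ∀ j < e, f.coeff (n - 1 - j) = 0) (hm : h.Monic) (hr : ∀ a, ¬ h.IsRoot a)
    (hh : h ∣ f) (hn : h.natDegree + ∑ a, d a + e = n) : f = 0 := by
  have hdvd : ∀ a, (X - C a) ^ d a ∣ f := by
    intro a
    rw [X_sub_C_pow_dvd_iff, X_pow_dvd_iff]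
    exact hd a
  have hprod : ∏ a, (X - C a) ^ d a ∣ f := by
    refine Finset.prod_dvd_of_coprime ?_ fun a _ => hdvd a
    intro a _ b _ hab
    exact (pairwise_coprime_X_sub_C Function.injective_id hab).pow
  have hcop : IsCoprime h (∏ a, (X - C a) ^ d a) := by
    refine IsCoprime.prod_right fun a _ => IsCoprime.pow_right ?_
    refine IsCoprime.symm ?_
    rw [(irreducible_X_sub_C a).coprime_iff_not_dvd, dvd_iff_isRoot]
    exact hr a
  have hall := hcop.mul_dvd hh hprod
  have hpm : (∏ a, (X - C a) ^ d a).Monic :=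
    monic_prod_of_monic _ _ fun a _ => (monic_X_sub_C a).pow _
  by_contra hf0
  have hle := natDegree_le_of_dvd hall hf0
  rw [hm.natDegree_mul hpm, natDegree_prod_of_monic _ _ fun a _ => (monic_X_sub_C a).pow _] at hle
  simp only [natDegree_pow, natDegree_X_sub_C, mul_one] at hle
  refine hf0 (leadingCoeff_eq_zero.mp ?_)
  rw [leadingCoeff]
  by_cases hlt : f.natDegree < n
  · have := he (n - 1 - f.natDegree) (by omega)
    rwa [show n - 1 - (n - 1 - f.natDegree) = f.natDegree by omega] at this
  · exact hf _ (by omega)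

/-- The entry, at depth `j` from the top of a block, of the array built from polynomials of degree
less than `n`: Taylor coefficients at the points of `F`, leading coefficients at infinity, and the
values `r` in the additional block. -/
noncomputable def pointEntry (n : ℕ) (f : F[X]) (r : ℕ → F) : Option (Option F) → ℕ → F
  | some (some a), j => (taylor a f).coeff j
  | some none, j => f.coeff (n - 1 - j)
  | none, j => r j

/-- The entries of the additional block: the `g`-adic remainders if `i = m`, and the entries of
`w` not used by the polynomial otherwise. -/
noncomputable def extraEntry {t : ℕ} (g : F[X]) (m i : ℕ) (w : Fin t → F) (j : ℕ) : F :=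
  if i = m then (vecPoly t w %ₘ g ^ (j / 2 + 1)).coeff j
  else if h : t - (2 * i + 1) + j < t then w ⟨t - (2 * i + 1) + j, h⟩ else 0

/-- The number of coefficients used by the polynomials of the `i`-th array. -/
def polyLen (t m i : ℕ) : ℕ := if i = m then t else t - (2 * i + 1)

/-- The entry of row `w` of the `i`-th array. -/
noncomputable def rowEntry {t : ℕ} (g : F[X]) (m i : ℕ) (w : Fin t → F) :
    Option (Option F) → ℕ → F :=
  pointEntry (polyLen t m i) (vecPoly (polyLen t m i) w) (extraEntry g m i w)

/-- The index of the array that covers the sets with `k` elements in the additional block. -/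
def arrayIndex (m k : ℕ) : ℕ := if k % 2 = 0 then m else k / 2

theorem rowEntry_injective [Fintype F] {t m : ℕ} (ht : t = 2 * m + 1) {g : F[X]} (hg : g.Monic)
    (hg2 : g.natDegree = 2) (hgr : ∀ a, ¬ g.IsRoot a) (d : Option (Option F) → ℕ)
    (hd : ∑ b, d b = t) {w w' : Fin t → F}
    (h : ∀ b, ∀ j < d b, rowEntry g m (arrayIndex m (d none)) w b j =
      rowEntry g m (arrayIndex m (d none)) w' b j) : w = w' := by
  set k := d none with hk
  simp only [Fintype.sum_option] at hd
  set i := arrayIndex m k with hi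
  set n := polyLen t m i with hn
  have hT : ∀ a, ∀ j < d (some (some a)), (taylor a (vecPoly n w - vecPoly n w')).coeff j = 0 := by
    intro a j hj
    have := h _ j hj
    simp only [rowEntry, pointEntry] at this
    rw [map_sub, coeff_sub, this, sub_self]
  have hI : ∀ j < d (some none), (vecPoly n w - vecPoly n w').coeff (n - 1 - j) = 0 := by
    intro j hj
    have := h _ j hj
    simp only [rowEntry, pointEntry] at this
    rw [coeff_sub, this, sub_self]
  have hE : ∀ j < k, extraEntry g m i w j = extraEntry g m i w' j := fun j hj => h none j hj
  have hdeg : ∀ j, n ≤ j → (vecPoly n w - vecPoly n w').coeff j = 0 := by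
    intro j hj
    rw [coeff_sub, coeff_vecPoly_of_le n w hj, coeff_vecPoly_of_le n w' hj, sub_self]
  by_cases him : i = m
  · have hnt : n = t := by rw [hn, polyLen, if_pos him]
    have hM : ∀ j < k, ((vecPoly n w - vecPoly n w') %ₘ g ^ (j / 2 + 1)).coeff j = 0 := by
      intro j hj
      have := hE j hj
      rw [extraEntry, extraEntry, if_pos him, if_pos him] at this
      rw [hnt, sub_modByMonic, coeff_sub, this, sub_self]
    have hdvd := pow_dvd_of_coeff_modByMonic hg hg2 (k / 2) fun j hj => hM j (by omega)
    have hroot : ∀ a, ¬ (g ^ (k / 2)).IsRoot a := by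
      intro a ha
      rw [IsRoot.def, eval_pow] at ha
      exact hgr a (eq_zero_of_pow_eq_zero ha)
    have hz : vecPoly n w - vecPoly n w' = 0 := by
      by_cases hk2 : k % 2 = 0
      · refine eq_zero_of_zeros hdeg hT hI (hg.pow _) hroot hdvd ?_
        rw [hg.natDegree_pow, hg2]
        omega
      · have hkt : k = t := by
          rw [hi, arrayIndex, if_neg hk2] at him
          omega
        have hs : d (some none) = 0 ∧ ∑ a, d (some (some a)) = 0 := by omega
        have hlt : (vecPoly n w - vecPoly n w').natDegree < 2 * m + 2 := by
          rw [Nat.lt_succ_iff, natDegree_le_iff_coeff_eq_zero]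
          intro N hN
          exact hdeg N (by omega)
        have hmod : (vecPoly n w - vecPoly n w') %ₘ g ^ (m + 1) = vecPoly n w - vecPoly n w' := by
          rw [modByMonic_eq_self_iff (hg.pow _)]
          refine degree_lt_degree ?_
          rw [hg.natDegree_pow, hg2]
          omega
        refine eq_zero_of_zeros (n := 2 * m) (e := 0) (d := 0) (h := g ^ (k / 2)) ?_
          (by simp) (by simp) (hg.pow _) hroot hdvd ?_
        · intro j hj
          rcases hj.eq_or_lt with rfl | hj
          · have := hM (2 * m) (by omega)
            rwa [show 2 * m / 2 + 1 = m + 1 by omega, hmod] at this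
          · exact hdeg j (by omega)
        · rw [hg.natDegree_pow, hg2]
          simp
          omega
    funext j
    exact apply_eq_of_vecPoly_eq (sub_eq_zero.mp hz) j (by omega)
  · have hk2 : ¬ k % 2 = 0 := fun h0 => him (by rw [hi, arrayIndex, if_pos h0])
    have hik : i = k / 2 := by rw [hi, arrayIndex, if_neg hk2]
    have hnt : n = t - k := by
      rw [hn, polyLen, if_neg him]
      omega
    have hz : vecPoly n w - vecPoly n w' = 0 := by
      refine eq_zero_of_zeros hdeg hT hI monic_one (by simp) (one_dvd _) ?_
      rw [natDegree_one]
      omega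
    funext j
    by_cases hj : (j : ℕ) < n
    · exact apply_eq_of_vecPoly_eq (sub_eq_zero.mp hz) j hj
    · have := hE (j - n) (by omega)
      rw [extraEntry, extraEntry, if_neg him, if_neg him] at this
      have hjj : t - (2 * i + 1) + (j - n) = (j : ℕ) := by omega
      simpa [hjj] using this

end Field

/-- For odd `t = 2m + 1`, an ordered covering array with `(m + 1) v ^ t` rows. -/
theorem isOCA_of_odd {v t m : ℕ} (hv : IsPrimePow v) (ht : t = 2 * m + 1) :
    IsOCA 1 ((m + 1) * v ^ t) t (v + 2) t v := by
  obtain ⟨p, e, hp, he, rfl⟩ := hv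
  have : Fact p.Prime := ⟨hp.nat_prime⟩
  let F := GaloisField p e
  have : Fintype F := Fintype.ofFinite F
  have hF : Fintype.card F = p ^ e := by
    rw [← Nat.card_eq_fintype_card]
    exact GaloisField.card p e he.ne'
  obtain ⟨g, hg, hg2, hgr⟩ := exists_monic_quadratic_no_root (F := F)
  let σ : F ≃ Fin (p ^ e) := Fintype.equivFinOfCardEq hF
  let β : Fin (p ^ e + 2) ≃ Option (Option F) :=
    (Fintype.equivFinOfCardEq (by simp [hF])).symm
  let ρ : Fin ((m + 1) * (p ^ e) ^ t) ≃ Fin (m + 1) × (Fin t → F) :=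
    (Fintype.equivFinOfCardEq (by simp [hF])).symm
  refine ⟨fun r c => σ (rowEntry g m (ρ r).1 (ρ r).2 (β c.1) (t - 1 - c.2)), ?_⟩
  intro J hJ hcard f
  set d : Option (Option F) → ℕ :=
    fun b => (Finset.univ.filter (fun q : Fin t => (β.symm b, q) ∈ J)).card with hd
  have hsum : ∑ b, d b = t := by
    rw [← hcard, ← sum_card_block J]
    exact Equiv.sum_comp β.symm fun i => (Finset.univ.filter (fun q : Fin t => (i, q) ∈ J)).card
  have hk : d none ≤ t := by
    rw [← hsum]
    exact Finset.single_le_sum (fun _ _ => Nat.zero_le _) (Finset.mem_univ none)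
  have hi : arrayIndex m (d none) < m + 1 := by
    rw [arrayIndex]
    split_ifs <;> omega
  let Φ : (Fin t → F) → J → F := fun w c =>
    rowEntry g m (arrayIndex m (d none)) w (β c.1.1) (t - 1 - c.1.2)
  have hinj : Function.Injective Φ := by
    intro w w' hw
    refine rowEntry_injective ht hg hg2 hgr d hsum fun b j hj => ?_
    have hdt : d b ≤ t := (Finset.card_le_univ _).trans (by simp)
    have hmem : (β.symm b, (⟨t - 1 - j, by omega⟩ : Fin t)) ∈ J := by
      refine hJ.mem_of_rev_lt _ _ ?_
      have : t - 1 - (t - 1 - j) = j := by omega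
      simpa [this] using hj
    have := congrFun hw ⟨_, hmem⟩
    have hjj : t - 1 - (t - 1 - j) = j := by omega
    simpa [Φ, hjj] using this
  have hbij : Function.Bijective Φ := by
    rw [Fintype.bijective_iff_injective_and_card]
    exact ⟨hinj, by simp [hcard]⟩
  obtain ⟨w, hw⟩ := hbij.2 fun c => σ.symm (f c.1)
  rw [Nat.one_le_iff_ne_zero, ← Nat.pos_iff_ne_zero, Finset.card_pos]
  refine ⟨ρ.symm (⟨_, hi⟩, w), ?_⟩
  rw [Finset.mem_filter]
  refine ⟨Finset.mem_univ _, fun c hc => ?_⟩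
  have := congrFun hw ⟨c, hc⟩
  simp only [Equiv.apply_symm_apply]
  rw [← Equiv.eq_symm_apply]
  exact this

/-- The numerical comparison between `(m + 1) v ^ (2m + 1)` and the stated bound. -/
theorem odd_bound_le {x : ℝ} (hx : 2 ≤ x) (m : ℕ) :
    (m + 1) * x ^ (2 * m + 1) ≤
      (2 * m + 1) * x ^ (2 * m + 1) - 2 / (x - 1) * (x ^ (2 * m + 1) - x ^ (m + 1)) := by
  have hx1 : x - 1 ≠ 0 := by linarith
  have hgeom : 2 / (x - 1) * (x ^ (2 * m + 1) - x ^ (m + 1)) =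
      x ^ (m + 1) * ∑ i ∈ Finset.range m, 2 * x ^ i := by
    rw [← Finset.mul_sum, geom_sum_eq (by linarith)]
    field_simp
    ring
  have hle : ∑ i ∈ Finset.range m, 2 * x ^ i ≤ m * x ^ m := by
    have : ∀ i ∈ Finset.range m, 2 * x ^ i ≤ x ^ m := by
      intro i hi
      rw [Finset.mem_range] at hi
      calc 2 * x ^ i ≤ x * x ^ i := by gcongr
        _ = x ^ (i + 1) := by ring
        _ ≤ x ^ m := pow_le_pow_right₀ (by linarith) hi
    simpa using Finset.sum_le_sum this
  have hmul := mul_le_mul_of_nonneg_left hle (by positivity : 0 ≤ x ^ (m + 1))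
  rw [hgeom]
  have : x ^ (m + 1) * (m * x ^ m) = m * x ^ (2 * m + 1) := by ring
  linarith

/-- For `v` a prime power and `t ≥ 3` odd:
`OCAN(t, v+2, t, v) ≤ t·v^t - (2/(v-1))·(v^t - v^{(t+1)/2})`. -/
theorem stmt_11 (v t : ℕ) (hv : IsPrimePow v) (ht : 3 ≤ t) (hodd : Odd t) :
    (OCAN 1 t (v + 2) t v : ℝ) ≤
      t * (v : ℝ) ^ t - (2 / ((v : ℝ) - 1)) * ((v : ℝ) ^ t - (v : ℝ) ^ ((t + 1) / 2)) := by
  obtain ⟨m, hm⟩ := hodd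
  have hle : OCAN 1 t (v + 2) t v ≤ (m + 1) * v ^ t := Nat.sInf_le (isOCA_of_odd hv hm)
  have hv2 : (2 : ℝ) ≤ v := by exact_mod_cast hv.two_le
  have hb := odd_bound_le hv2 m
  subst hm
  rw [show (2 * m + 1 + 1) / 2 = m + 1 by omega]
  refine le_trans (by exact_mod_cast hle) (le_trans hb (le_of_eq ?_))
  push_cast
  ring
end

section
/- Let v, q, s, k be integers with v ≥ 2, q ≥ 2, s ≥ 3, and k ≥ 1. For every j with 0 ≤ j ≤ s, K_{vq}(2k+1, s, (k+1)s − j) ≤ OCAN(ks + j, 2k+1, s, v)·(q^{ks+j} − q^{k(s−2)+j}·(q^k − 1)). -/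
/-- The NRT distance on `Z_q^{ms}` (coordinates indexed by `Fin m × Fin s`,
block `i`, position `a` within block): the cardinality of the ideal of the NRT
poset `[m·s]` generated by the support of `x - y`; a coordinate `(i, a)` lies in
this ideal iff `x` and `y` differ at some `(i, b)` with `a ≤ b`. -/
def nrtDist (m s q : ℕ) (x y : Fin m × Fin s → Fin q) : ℕ :=
  (Finset.univ.filter (fun c : Fin m × Fin s =>
    ∃ b : Fin s, c.2 ≤ b ∧ x (c.1, b) ≠ y (c.1, b))).card

/-- `nrtK q m s R` is the smallest cardinality of an `R`-covering code of the
NRT space `Z_q^{ms}`. -/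
noncomputable def nrtK (q m s R : ℕ) : ℕ :=
  sInf {n | ∃ C : Finset (Fin m × Fin s → Fin q), C.card = n ∧
    ∀ x : Fin m × Fin s → Fin q, ∃ c ∈ C, nrtDist m s q x c ≤ R}

open Finset in
/-- Two words that agree on an anti-ideal `J` are at NRT distance at most `ms - |J|`. -/
theorem nrtDist_add_card_le {m s q : ℕ} {x y : Fin m × Fin s → Fin q}
    {J : Finset (Fin m × Fin s)} (hJ : IsAntiIdeal m s J) (hxy : ∀ c ∈ J, x c = y c) :
    nrtDist m s q x y + J.card ≤ m * s := by
  unfold nrtDist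
  rw [← card_union_of_disjoint]
  · simpa using card_le_univ (α := Fin m × Fin s) _
  · rw [disjoint_left]
    rintro ⟨i, a⟩ hc hcJ
    obtain ⟨b, hab, hne⟩ := (mem_filter.mp hc).2
    exact hne (hxy _ (hJ i a b hab hcJ))

/-- The anti-ideal consisting of the top `h i` elements of each block `i`. -/
def topAntiIdeal (m s : ℕ) (h : Fin m → ℕ) : Finset (Fin m × Fin s) :=
  Finset.univ.filter fun c => s ≤ c.2 + h c.1

theorem mem_topAntiIdeal {m s : ℕ} {h : Fin m → ℕ} {c : Fin m × Fin s} :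
    c ∈ topAntiIdeal m s h ↔ s ≤ c.2 + h c.1 := by
  simp [topAntiIdeal]

theorem isAntiIdeal_topAntiIdeal (m s : ℕ) (h : Fin m → ℕ) :
    IsAntiIdeal m s (topAntiIdeal m s h) := by
  intro i a b hab ha
  rw [mem_topAntiIdeal] at ha ⊢
  have : (a : ℕ) ≤ b := hab
  simp only at ha ⊢
  omega

theorem card_filter_le_add {s h : ℕ} (hh : h ≤ s) :
    (Finset.univ.filter fun a : Fin s => s ≤ a + h).card = h := by
  have hcompl := Finset.card_filter_add_card_filter_not
    (s := (Finset.univ : Finset (Fin s))) (fun a : Fin s => (a : ℕ) < s - h)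
  rw [Fin.card_filter_val_lt, Finset.card_univ, Fintype.card_fin] at hcompl
  have heq : (Finset.univ.filter fun a : Fin s => s ≤ a + h) =
      Finset.univ.filter fun a : Fin s => ¬ (a : ℕ) < s - h := by
    ext a
    simp only [Finset.mem_filter, Finset.mem_univ, true_and]
    omega
  rw [heq]
  omega

theorem card_topAntiIdeal {m s : ℕ} {h : Fin m → ℕ} (hh : ∀ i, h i ≤ s) :
    (topAntiIdeal m s h).card = ∑ i, h i := by
  unfold topAntiIdeal
  rw [Finset.card_filter, Fintype.sum_prod_type]
  refine Finset.sum_congr rfl fun i _ => ?_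
  rw [← Finset.card_filter, card_filter_le_add (hh i)]

/-- The height profile equal to `α` on the first `k` blocks, `β` on the next `k` blocks and `γ`
on the last block. -/
def blockHeights (k α β γ : ℕ) (i : Fin (2 * k + 1)) : ℕ :=
  if (i : ℕ) < k then α else if (i : ℕ) < 2 * k then β else γ

theorem sum_blockHeights (k α β γ : ℕ) :
    ∑ i, blockHeights k α β γ i = k * α + k * β + γ := by
  unfold blockHeights
  rw [Fin.sum_univ_eq_sum_range
    (fun i => if i < k then α else if i < 2 * k then β else γ) (2 * k + 1),
    Finset.sum_range_succ, two_mul, Finset.sum_range_add]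
  congr 1
  · congr 1
    · rw [Finset.sum_congr rfl fun i hi => if_pos (Finset.mem_range.mp hi)]
      simp
    · rw [Finset.sum_congr rfl (g := fun _ => β)]
      · simp
      · intro i hi
        have := Finset.mem_range.mp hi
        rw [if_neg (by omega), if_pos (by omega)]
  · rw [if_neg (by omega), if_neg (by omega)]

theorem card_topAntiIdeal_blockHeights {k s α β γ : ℕ} (hα : α ≤ s) (hβ : β ≤ s) (hγ : γ ≤ s) :
    (topAntiIdeal (2 * k + 1) s (blockHeights k α β γ)).card = k * α + k * β + γ := by
  rw [card_topAntiIdeal, sum_blockHeights]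
  intro i
  unfold blockHeights
  split_ifs <;> assumption

theorem exists_isOCA (t m s v : ℕ) : ∃ N, IsOCA 1 N t m s v := by
  refine ⟨Fintype.card (Fin m × Fin s → Fin v), (Fintype.equivFin _).symm, fun J _ _ f => ?_⟩
  rw [Nat.one_le_iff_ne_zero, ← Nat.pos_iff_ne_zero, Finset.card_pos]
  exact ⟨Fintype.equivFin _ f, by simp⟩

/-- `C` covers every word by agreement on an anti-ideal of size `t`. -/
def IsAgreementCovering (t m s q : ℕ) (C : Finset (Fin m × Fin s → Fin q)) : Prop :=
  ∀ x : Fin m × Fin s → Fin q, ∃ c ∈ C, ∃ J, IsAntiIdeal m s J ∧ J.card = t ∧ ∀ p ∈ J, x p = c p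

/-- Combining an ordered covering array over `Fin v` with a covering over `Fin q` yields a
covering over `Fin (v * q)`. -/
theorem nrtK_mul_le {t m s v q R : ℕ} (hR : m * s ≤ R + t) {C : Finset (Fin m × Fin s → Fin q)}
    (hC : IsAgreementCovering t m s q C) :
    nrtK (v * q) m s R ≤ OCAN 1 t m s v * C.card := by
  obtain ⟨A, hA⟩ : IsOCA 1 (OCAN 1 t m s v) t m s v := Nat.sInf_mem (exists_isOCA t m s v)
  let D := (Finset.univ ×ˢ C).image fun rc : Fin (OCAN 1 t m s v) × (Fin m × Fin s → Fin q) =>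
    fun p => finProdFinEquiv (A rc.1 p, rc.2 p)
  have hD : D.card ≤ OCAN 1 t m s v * C.card := by
    refine Finset.card_image_le.trans ?_
    simp [Finset.card_product]
  refine le_trans (Nat.sInf_le ⟨D, rfl, fun x => ?_⟩) hD
  obtain ⟨c, hc, J, hJ, hJt, hxc⟩ := hC fun p => (finProdFinEquiv.symm (x p)).2
  obtain ⟨r, hr⟩ := Finset.card_pos.mp (hA J hJ hJt fun p => (finProdFinEquiv.symm (x p)).1)
  rw [Finset.mem_filter] at hr
  refine ⟨fun p => finProdFinEquiv (A r p, c p),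
    Finset.mem_image.mpr ⟨(r, c), by simp [hc], rfl⟩, ?_⟩
  have hdist := nrtDist_add_card_le (x := x) (y := fun p => finProdFinEquiv (A r p, c p)) hJ
    fun p hp => by
      rw [hr.2 p hp, ← hxc p hp]
      exact (finProdFinEquiv.apply_symm_apply (x p)).symm
  omega

/-- Words on `k` blocks of length `n + 2` whose top coordinates all vanish but whose bottom
coordinates do not all vanish. -/
def IsRedundant {k n q : ℕ} [NeZero q] (w : Fin k → Fin (n + 2) → Fin q) : Prop :=
  (∀ i, w i (Fin.last (n + 1)) = 0) ∧ ¬ ∀ i, w i 0 = 0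

open Classical in
theorem le_card_isRedundant (k n q : ℕ) [NeZero q] :
    q ^ (k * n) * (q ^ k - 1) ≤
      (Finset.univ.filter fun w : Fin k → Fin (n + 2) → Fin q => IsRedundant w).card := by
  let S : Finset ((Fin k → Fin n → Fin q) × (Fin k → Fin q)) :=
    Finset.univ ×ˢ Finset.univ.erase 0
  have hS : S.card = q ^ (k * n) * (q ^ k - 1) := by
    rw [Finset.card_product, Finset.card_erase_of_mem (Finset.mem_univ _)]
    simp [← pow_mul, mul_comm]
  rw [← hS]
  refine Finset.card_le_card_of_injOn
    (fun gb i => Fin.cons (gb.2 i) (Fin.snoc (gb.1 i) 0 : Fin (n + 1) → Fin q)) ?_ ?_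
  · rintro ⟨g, b⟩ hgb
    have hb : b ≠ 0 := by simpa [S] using hgb
    refine Finset.mem_coe.mpr (Finset.mem_filter.mpr ⟨Finset.mem_univ _, fun i => ?_, ?_⟩)
    · rw [← Fin.succ_last]
      exact (Fin.cons_succ _ _ _).trans (Fin.snoc_last _ _)
    · exact fun h => hb (funext h)
  · rintro ⟨g, b⟩ - ⟨g', b'⟩ - h
    have h' := fun i => Fin.cons_inj.mp (congrFun h i)
    exact Prod.ext (funext fun i => (Fin.snoc_inj.mp (h' i).2).1) (funext fun i => (h' i).1)

/-- The word on `2k + 1` blocks consisting of two copies of `w` followed by a block whose top `j`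
coordinates are given by `u`. -/
def doubledWord {k s j q : ℕ} [NeZero q] (w : Fin k → Fin s → Fin q) (u : Fin j → Fin q)
    (p : Fin (2 * k + 1) × Fin s) : Fin q :=
  if h₁ : (p.1 : ℕ) < k then w ⟨p.1, h₁⟩ p.2
  else if h₂ : (p.1 : ℕ) < 2 * k then w ⟨p.1 - k, by omega⟩ p.2
  else if h₃ : s ≤ p.2 + j then u ⟨p.2 + j - s, by omega⟩ else 0

/-- To agree with `doubledWord w u` on the anti-ideal with heights `α`, `β`, `j` it suffices to
agree on each of the three groups of blocks. -/
theorem eq_doubledWord_of_mem {k s j q α β : ℕ} [NeZero q] {w : Fin k → Fin s → Fin q}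
    {u : Fin j → Fin q} {x : Fin (2 * k + 1) × Fin s → Fin q}
    (hfst : ∀ (i : Fin k) (a : Fin s), s ≤ a + α → x (⟨i, by omega⟩, a) = w i a)
    (hsnd : ∀ (i : Fin k) (a : Fin s), s ≤ a + β → x (⟨k + i, by omega⟩, a) = w i a)
    (hlast : ∀ (a : Fin s) (h : s ≤ a + j), x (Fin.last (2 * k), a) = u ⟨a + j - s, by omega⟩)
    (p : Fin (2 * k + 1) × Fin s)
    (hp : p ∈ topAntiIdeal (2 * k + 1) s (blockHeights k α β j)) :
    x p = doubledWord w u p := by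
  obtain ⟨i, a⟩ := p
  rw [mem_topAntiIdeal, blockHeights] at hp
  unfold doubledWord
  simp only at hp ⊢
  split_ifs at hp ⊢ with h₁ h₂
  · exact hfst ⟨i, h₁⟩ a hp
  · rw [← hsnd ⟨i - k, by omega⟩ a hp]
    congr 2
    ext
    simp only
    omega
  · obtain rfl : i = Fin.last (2 * k) := by
      ext
      simp only [Fin.val_last]
      omega
    exact hlast a hp

open Classical in
/-- The code of all `doubledWord w u` with `w` not redundant. -/
noncomputable def doubledCode (k n j q : ℕ) [NeZero q] :
    Finset (Fin (2 * k + 1) × Fin (n + 2) → Fin q) :=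
  ((Finset.univ.filter fun w : Fin k → Fin (n + 2) → Fin q => ¬ IsRedundant w) ×ˢ
    (Finset.univ : Finset (Fin j → Fin q))).image fun wu => doubledWord wu.1 wu.2

theorem mem_doubledCode {k n j q : ℕ} [NeZero q] {w : Fin k → Fin (n + 2) → Fin q}
    (hw : ¬ IsRedundant w) (u : Fin j → Fin q) : doubledWord w u ∈ doubledCode k n j q := by
  classical
  exact Finset.mem_image.mpr ⟨(w, u), by simp [hw], rfl⟩

theorem card_doubledCode_le (k n j q : ℕ) [NeZero q] :
    (doubledCode k n j q).card ≤ q ^ (k * (n + 2) + j) - q ^ (k * n + j) * (q ^ k - 1) := by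
  classical
  have hsplit := Finset.card_filter_add_card_filter_not
    (s := (Finset.univ : Finset (Fin k → Fin (n + 2) → Fin q))) (fun w => IsRedundant w)
  have htotal : (Finset.univ : Finset (Fin k → Fin (n + 2) → Fin q)).card = q ^ (k * (n + 2)) := by
    simp [← pow_mul, mul_comm]
  have hred := le_card_isRedundant k n q
  refine Finset.card_image_le.trans ?_
  rw [Finset.card_product, pow_add, pow_add, mul_right_comm, ← Nat.sub_mul]
  refine Nat.mul_le_mul ?_ (by simp)
  omega

theorem isAgreementCovering_doubledCode {k n j q : ℕ} [NeZero q] (hj : j ≤ n + 2) :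
    IsAgreementCovering (k * (n + 2) + j) (2 * k + 1) (n + 2) q (doubledCode k n j q) := by
  intro x
  let w₁ : Fin k → Fin (n + 2) → Fin q := fun i a => x (⟨i, by omega⟩, a)
  let w₂ : Fin k → Fin (n + 2) → Fin q := fun i a => x (⟨k + i, by omega⟩, a)
  let u : Fin j → Fin q := fun b => x (Fin.last (2 * k), ⟨b + (n + 2) - j, by omega⟩)
  have hu : ∀ (a : Fin (n + 2)) (h : n + 2 ≤ a + j),
      x (Fin.last (2 * k), a) = u ⟨a + j - (n + 2), by omega⟩ := by
    intro a h
    simp only [u]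
    congr 2
    ext
    simp only
    omega
  by_cases h₁ : IsRedundant w₁
  · by_cases h₂ : IsRedundant w₂
    · let w : Fin k → Fin (n + 2) → Fin q := fun i a => if a = 0 then 0 else w₁ i a
      have hw : ¬ IsRedundant w := fun h => h.2 fun i => if_pos rfl
      refine ⟨_, mem_doubledCode hw u, _,
        isAntiIdeal_topAntiIdeal _ _ (blockHeights k (n + 1) 1 j), ?_,
        eq_doubledWord_of_mem (fun i a ha => ?_) (fun i a ha => ?_) hu⟩
      · rw [card_topAntiIdeal_blockHeights (by omega) (by omega) hj]
        ring
      · have : a ≠ 0 := by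
          rintro rfl
          simp at ha
        simp only [w, if_neg this, w₁]
      · obtain rfl : a = Fin.last (n + 1) := by
          ext
          simp only [Fin.val_last]
          omega
        have hne : Fin.last (n + 1) ≠ 0 := Fin.last_pos.ne'
        simp only [w, if_neg hne, h₁.1 i]
        exact h₂.1 i
    · refine ⟨_, mem_doubledCode h₂ u, _,
        isAntiIdeal_topAntiIdeal _ _ (blockHeights k 0 (n + 2) j), ?_,
        eq_doubledWord_of_mem (fun i a ha => ?_) (fun i a _ => rfl) hu⟩
      · rw [card_topAntiIdeal_blockHeights (by omega) le_rfl hj]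
        ring
      · omega
  · refine ⟨_, mem_doubledCode h₁ u, _,
      isAntiIdeal_topAntiIdeal _ _ (blockHeights k (n + 2) 0 j), ?_,
      eq_doubledWord_of_mem (fun i a _ => rfl) (fun i a ha => ?_) hu⟩
    · rw [card_topAntiIdeal_blockHeights le_rfl (by omega) hj]
      ring
    · omega

/-- For `0 ≤ j ≤ s`:
`K_{vq}(2k+1, s, (k+1)s - j) ≤ OCAN(ks+j, 2k+1, s, v)·(q^{ks+j} - q^{k(s-2)+j}(q^k - 1))`. -/
theorem stmt_18 (v q s k j : ℕ) (hv : 2 ≤ v) (hq : 2 ≤ q) (hs : 3 ≤ s)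
    (hk : 1 ≤ k) (hj : j ≤ s) :
    nrtK (v * q) (2 * k + 1) s ((k + 1) * s - j) ≤
      OCAN 1 (k * s + j) (2 * k + 1) s v *
        (q ^ (k * s + j) - q ^ (k * (s - 2) + j) * (q ^ k - 1)) := by
  obtain ⟨n, rfl⟩ : ∃ n, s = n + 2 := ⟨s - 2, by omega⟩
  have : NeZero q := ⟨by omega⟩
  refine (nrtK_mul_le ?_ (isAgreementCovering_doubledCode hj)).trans
    (Nat.mul_le_mul_left _ (card_doubledCode_le k n j q))
  have hsum : (2 * k + 1) * (n + 2) = (k + 1) * (n + 2) + k * (n + 2) := by ring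
  have hle : n + 2 ≤ (k + 1) * (n + 2) := Nat.le_mul_of_pos_left _ (by omega)
  omega
end
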